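/- Let u be an arbitrary word and v, w nonempty words over V. Then u ↙ (vw) = Σ_{u=u¹u²} (u¹ ↙ v)(u² ∨ w), where vw and the juxtaposition on the right denote concatenation and the sum runs over all cuts of u (with the empty-word conventions for the quadri-algebra operations). -/

import Mathlib

open Finset MonoidAlgebra TensorProduct

/-- `Sh(p,q)`: permutations of the `p+q` indices that are increasing on the
first `p` indices and on the last `q` indices. -/
def IsSh (p q : ℕ) (σ : Equiv.Perm (Fin (p + q))) : Prop :=
  (∀ i j : Fin (p + q), (i : ℕ) < (j : ℕ) → (j : ℕ) < p → σ i < σ j) ∧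
  (∀ i j : Fin (p + q), p ≤ (i : ℕ) → (i : ℕ) < (j : ℕ) → σ i < σ j)

instance IsSh.decPred (p q : ℕ) : DecidablePred (IsSh p q) := fun _ => by
  unfold IsSh; infer_instance

/-- The word `u_{σ⁻¹(1)} u_{σ⁻¹(2)} ⋯ u_{σ⁻¹(p+q)}` where `u₁ ⋯ u_p` is `u` and
`u_{p+1} ⋯ u_{p+q}` is `v`. -/
def shWord {V : Type*} (u v : List V) (σ : Equiv.Perm (Fin (u.length + v.length))) :
    FreeMonoid V :=
  FreeMonoid.ofList
    (List.ofFn fun i => (u ++ v).get (Fin.cast (List.length_append (as := u) (bs := v)).symm (σ.symm i)))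

/-- `posCond p b i` says that the letter at (combined) index `i` comes from the second
word (`b = true`, i.e. `p ≤ i`) or from the first word (`b = false`, i.e. `i < p`). -/
def posCond (p : ℕ) (b : Bool) (i : ℕ) : Prop :=
  match b with
  | true => p ≤ i
  | false => i < p

instance posCond.dec (p : ℕ) (b : Bool) (i : ℕ) : Decidable (posCond p b i) := by
  cases b <;> unfold posCond <;> infer_instance

variable (k : Type*) [CommRing k] {V : Type*}

/-- The shuffle product `u ⧢ v` of two words, as an element of the monoid algebra
`H` of the free monoid on `V` (sum over all `(p,q)`-shuffles); in particular
`1 ⧢ a = a ⧢ 1 = a`. -/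
noncomputable def shuffleProd (u v : List V) : MonoidAlgebra k (FreeMonoid V) :=
  ∑ σ ∈ univ.filter (IsSh u.length v.length),
    MonoidAlgebra.single (shWord u v σ) (1 : k)

/-- Generic quadri-algebra operation on words: the part of the shuffle product `u ⧢ v`
consisting of the shuffles where the first (resp. last) letter comes from `v` iff `fb`
(resp. `lb`) is `true`.  (For a shuffle permutation, the first letter comes from `v`
iff `σ⁻¹(1) = p+1`, and from `u` iff `σ⁻¹(1) = 1`; the last letter comes from `v` iff
`σ⁻¹(p+q) = p+q`, and from `u` iff `σ⁻¹(p+q) = p`.)  This definition also encodes the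
empty-word conventions: `1 ↘ a = a` and `a ↖ 1 = a` for nonempty `a`, and all other
quadri-algebra operations with an empty argument are `0`. -/
noncomputable def quadOp (fb lb : Bool) (u v : List V) : MonoidAlgebra k (FreeMonoid V) :=
  ∑ σ ∈ univ.filter (fun σ : Equiv.Perm (Fin (u.length + v.length)) =>
      IsSh u.length v.length σ ∧
      ∃ h : 0 < u.length + v.length,
        posCond u.length fb (σ.symm ⟨0, h⟩) ∧
        posCond u.length lb (σ.symm ⟨u.length + v.length - 1, Nat.sub_lt h Nat.one_pos⟩)),
    MonoidAlgebra.single (shWord u v σ) (1 : k)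

/-- `u ↘ v` : shuffles whose first and last letters come from `v`. -/
noncomputable def seOp (u v : List V) : MonoidAlgebra k (FreeMonoid V) := quadOp k true true u v

/-- `u ↗ v` : shuffles whose first letter comes from `v` and last letter from `u`. -/
noncomputable def neOp (u v : List V) : MonoidAlgebra k (FreeMonoid V) := quadOp k true false u v

/-- `u ↖ v` : shuffles whose first and last letters come from `u`. -/
noncomputable def nwOp (u v : List V) : MonoidAlgebra k (FreeMonoid V) := quadOp k false false u v

/-- `u ↙ v` : shuffles whose first letter comes from `u` and last letter from `v`. -/
noncomputable def swOp (u v : List V) : MonoidAlgebra k (FreeMonoid V) := quadOp k false true u v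

/-- `u ≻ v := u ↗ v + u ↘ v`. -/
noncomputable def succOp (u v : List V) : MonoidAlgebra k (FreeMonoid V) := neOp k u v + seOp k u v

/-- `u ≺ v := u ↖ v + u ↙ v`. -/
noncomputable def precOp (u v : List V) : MonoidAlgebra k (FreeMonoid V) := nwOp k u v + swOp k u v

/-- `u ∨ v := u ↘ v + u ↙ v`. -/
noncomputable def veeOp (u v : List V) : MonoidAlgebra k (FreeMonoid V) := seOp k u v + swOp k u v

/-- `u ∧ v := u ↗ v + u ↖ v`. -/
noncomputable def wedgeOp (u v : List V) : MonoidAlgebra k (FreeMonoid V) := neOp k u v + nwOp k u v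

/-- Merge two lists following a list of labels (`false`: first list, `true`: second). -/
def mrg {α : Type*} : List Bool → List α → List α → List α
  | [], _, _ => []
  | true :: b, u, y :: v => y :: mrg b u v
  | true :: _, _, [] => []
  | false :: b, x :: u, v => x :: mrg b u v
  | false :: _, [], _ => []

theorem mrg_map {α β : Type*} (g : α → β) (b : List Bool) : ∀ (u v : List α),
    mrg b (u.map g) (v.map g) = (mrg b u v).map g := by
  induction b with
  | nil => intro u v; simp [mrg]
  | cons a b ih =>
    intro u v
    cases a
    · cases u with
      | nil => simp [mrg]
      | cons x u => simp [mrg, ih]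
    · cases v with
      | nil => simp [mrg]
      | cons x v => simp [mrg, ih]

theorem mrg_append {α : Type*} (b c : List Bool) (u' v' : List α) : ∀ (u v : List α),
    b.count false = u.length → b.count true = v.length →
    mrg (b ++ c) (u ++ u') (v ++ v') = mrg b u v ++ mrg c u' v' := by
  induction b with
  | nil =>
    intro u v hu hv
    have : u = [] := by simpa [eq_comm] using hu
    have : v = [] := by simpa [eq_comm] using hv
    subst_vars; simp [mrg]
  | cons a b ih =>
    intro u v hu hv
    cases a
    · cases u with
      | nil => simp at hu
      | cons x u => simp [mrg, ih u v (by simpa using hu) (by simpa using hv)]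
    · cases v with
      | nil => simp at hv
      | cons x v => simp [mrg, ih u v (by simpa using hu) (by simpa using hv)]

theorem mrg_self {α : Type*} (f : α → Bool) (l : List α) :
    mrg (l.map f) (l.filter (fun x => !f x)) (l.filter f) = l := by
  induction l with
  | nil => simp [mrg]
  | cons x l ih =>
    cases h : f x <;> simp [h, mrg, ih]

theorem mrg_spec {α : Type*} (f : α → Bool) (b : List Bool) : ∀ (u v : List α),
    b.count false = u.length → b.count true = v.length →
    (∀ x ∈ u, f x = false) → (∀ x ∈ v, f x = true) →
    (mrg b u v).map f = b ∧ (mrg b u v).filter (fun x => !f x) = u ∧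
      (mrg b u v).filter f = v := by
  induction b with
  | nil =>
    intro u v hu hv
    have : u = [] := by simpa [eq_comm] using hu
    have : v = [] := by simpa [eq_comm] using hv
    subst_vars; simp [mrg]
  | cons a b ih =>
    intro u v hu hv hfu hfv
    cases a
    · cases u with
      | nil => simp at hu
      | cons x u =>
        have := ih u v (by simpa using hu) (by simpa using hv)
          (fun y hy => hfu y (by simp [hy])) hfv
        have hx := hfu x (by simp)
        simp [mrg, hx, this]
    · cases v with
      | nil => simp at hv
      | cons x v =>
        have := ih u v (by simpa using hu) (by simpa using hv) hfu
          (fun y hy => hfv y (by simp [hy]))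
        have hx := hfv x (by simp)
        simp [mrg, hx, this]

/-- Label words with `p` letters `false` and `q` letters `true`. -/
def labs (p q : ℕ) : Finset (List Bool) :=
  (List.replicate p false ++ List.replicate q true).permutations.toFinset

theorem mem_labs (p q : ℕ) (b : List Bool) :
    b ∈ labs p q ↔ b.count false = p ∧ b.count true = q := by
  simp [labs, List.perm_iff_count, List.count_replicate]

theorem length_of_mem_labs {p q : ℕ} {b : List Bool} (h : b ∈ labs p q) : b.length = p + q := by
  rw [mem_labs] at h
  have := List.count_not_add_count b true
  rw [Bool.not_true] at this
  omega

def fl (p q : ℕ) (x : Fin (p + q)) : Bool := decide (p ≤ (x : ℕ))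

def lA (p q : ℕ) : List (Fin (p + q)) := List.ofFn (Fin.castAdd q)
def lB (p q : ℕ) : List (Fin (p + q)) := List.ofFn (Fin.natAdd p)

theorem mem_lA (p q : ℕ) (x : Fin (p + q)) : x ∈ lA p q ↔ fl p q x = false := by
  simp only [lA, List.mem_ofFn, fl, decide_eq_false_iff_not, not_le]
  constructor
  · rintro ⟨y, rfl⟩; simp
  · intro h; exact ⟨⟨x, h⟩, by ext; simp⟩

theorem mem_lB (p q : ℕ) (x : Fin (p + q)) : x ∈ lB p q ↔ fl p q x = true := by
  simp only [lB, List.mem_ofFn, fl, decide_eq_true_eq]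
  constructor
  · rintro ⟨y, rfl⟩; simp
  · intro h; exact ⟨⟨x - p, by omega⟩, by ext; simp; omega⟩

theorem lA_pw (p q : ℕ) : (lA p q).Pairwise (· < ·) := by
  simp only [lA, List.pairwise_ofFn]
  intro i j h
  rw [Fin.lt_def] at h ⊢
  simpa using h

theorem lB_pw (p q : ℕ) : (lB p q).Pairwise (· < ·) := by
  simp only [lB, List.pairwise_ofFn]
  intro i j h
  rw [Fin.lt_def] at h ⊢
  simpa using h

theorem pw_ext {n : ℕ} {l m : List (Fin n)} (hl : l.Pairwise (· < ·)) (hm : m.Pairwise (· < ·))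
    (h : ∀ x, x ∈ l ↔ x ∈ m) : l = m := by
  have hp : l.Perm m := (List.perm_ext_iff_of_nodup (hl.imp ne_of_lt) (hm.imp ne_of_lt)).2 h
  exact hp.eq_of_pairwise (fun a b _ _ h1 h2 => absurd h1 (lt_asymm h2)) hl hm

theorem isSh_iff (p q : ℕ) (σ : Equiv.Perm (Fin (p + q))) :
    IsSh p q σ ↔ (List.ofFn σ.symm).filter (fun x => !fl p q x) = lA p q ∧
      (List.ofFn σ.symm).filter (fl p q) = lB p q := by
  have key : IsSh p q σ ↔ ((List.ofFn σ.symm).filter (fun x => !fl p q x)).Pairwise (· < ·) ∧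
      ((List.ofFn σ.symm).filter (fl p q)).Pairwise (· < ·) := by
    simp only [List.pairwise_filter, List.pairwise_ofFn, fl, IsSh]
    simp only [Bool.not_eq_true', decide_eq_false_iff_not, not_le, decide_eq_true_eq]
    constructor
    · rintro ⟨h1, h2⟩
      constructor
      · intro i j hij hi hj
        by_contra hc
        have hne : σ.symm i ≠ σ.symm j := fun h => hij.ne (σ.symm.injective h)
        have := h1 (σ.symm j) (σ.symm i) (Fin.lt_def.1 (lt_of_le_of_ne (not_lt.1 hc) hne.symm)) hi
        simp at this
        exact lt_asymm this hij
      · intro i j hij hi hj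
        by_contra hc
        have hne : σ.symm i ≠ σ.symm j := fun h => hij.ne (σ.symm.injective h)
        have := h2 (σ.symm j) (σ.symm i) hj (Fin.lt_def.1 (lt_of_le_of_ne (not_lt.1 hc) hne.symm))
        simp at this
        exact lt_asymm this hij
    · rintro ⟨h1, h2⟩
      constructor
      · intro i j hij hj
        by_contra hc
        have hne : σ i ≠ σ j := fun h => by
          have := σ.injective h
          subst this; omega
        have := h1 (lt_of_le_of_ne (not_lt.1 hc) hne.symm) (by simpa using hj)
          (by simp; omega)
        rw [Equiv.symm_apply_apply, Equiv.symm_apply_apply, Fin.lt_def] at this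
        omega
      · intro i j hi hij
        by_contra hc
        have hne : σ i ≠ σ j := fun h => by
          have := σ.injective h
          subst this; omega
        have := h2 (lt_of_le_of_ne (not_lt.1 hc) hne.symm) (by simp; omega)
          (by simpa using hi)
        rw [Equiv.symm_apply_apply, Equiv.symm_apply_apply, Fin.lt_def] at this
        omega
  rw [key]
  constructor
  · rintro ⟨h1, h2⟩
    refine ⟨pw_ext h1 (lA_pw p q) ?_, pw_ext h2 (lB_pw p q) ?_⟩
    · intro x
      rw [mem_lA]
      simp only [List.mem_filter, List.mem_ofFn]
      simpa using fun _ => ⟨σ x, by simp⟩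
    · intro x
      rw [mem_lB]
      simp only [List.mem_filter, List.mem_ofFn]
      simpa using fun _ => ⟨σ x, by simp⟩
  · rintro ⟨h1, h2⟩
    rw [h1, h2]
    exact ⟨lA_pw p q, lB_pw p q⟩

/-- The label word of a permutation. -/
def lab (p q : ℕ) (σ : Equiv.Perm (Fin (p + q))) : List Bool := (List.ofFn σ.symm).map (fl p q)

theorem mrg_lab {p q : ℕ} {σ : Equiv.Perm (Fin (p + q))} (h : IsSh p q σ) :
    mrg (lab p q σ) (lA p q) (lB p q) = List.ofFn σ.symm := by
  rw [isSh_iff] at h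
  have := mrg_self (fl p q) (List.ofFn σ.symm)
  rwa [h.1, h.2] at this

theorem lab_inj {p q : ℕ} {σ τ : Equiv.Perm (Fin (p + q))} (h : IsSh p q σ) (h' : IsSh p q τ)
    (e : lab p q σ = lab p q τ) : σ = τ := by
  have h1 := mrg_lab h
  rw [e, mrg_lab h'] at h1
  have h2 := List.ofFn_injective h1
  have : τ.symm = σ.symm := DFunLike.coe_injective h2
  exact (Equiv.symm_bijective.injective this).symm

theorem lab_mem {p q : ℕ} {σ : Equiv.Perm (Fin (p + q))} (h : IsSh p q σ) :
    lab p q σ ∈ labs p q := by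
  rw [isSh_iff] at h
  rw [mem_labs]
  have h1 := congrArg List.length h.1
  have h2 := congrArg List.length h.2
  rw [← List.countP_eq_length_filter] at h1 h2
  simp only [lA, lB, List.length_ofFn] at h1 h2
  refine ⟨?_, ?_⟩
  · rw [lab, List.count, List.countP_map]
    refine Eq.trans ?_ h1
    refine List.countP_congr ?_
    intro x _; simp
  · rw [lab, List.count, List.countP_map]
    refine Eq.trans ?_ h2
    refine List.countP_congr ?_
    intro x _; simp

theorem lab_surj {p q : ℕ} {b : List Bool} (hb : b ∈ labs p q) :
    ∃ σ, IsSh p q σ ∧ lab p q σ = b := by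
  have hlen := length_of_mem_labs hb
  rw [mem_labs] at hb
  obtain ⟨h1, h2, h3⟩ := mrg_spec (fl p q) b (lA p q) (lB p q) (by simp [lA, hb.1])
    (by simp [lB, hb.2]) (fun x hx => (mem_lA p q x).1 hx) (fun x hx => (mem_lB p q x).1 hx)
  set l := mrg b (lA p q) (lB p q) with hl
  have hll : l.length = p + q := by
    have := congrArg List.length h1
    simpa [hlen] using this
  have hsurj : ∀ x, x ∈ l := by
    intro x
    cases hx : fl p q x
    · have := (mem_lA p q x).2 hx
      rw [← h2] at this
      exact (List.mem_filter.1 this).1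
    · have := (mem_lB p q x).2 hx
      rw [← h3] at this
      exact (List.mem_filter.1 this).1
  let f : Fin (p + q) → Fin (p + q) := fun i => l.get (Fin.cast hll.symm i)
  have hf : Function.Surjective f := by
    intro x
    obtain ⟨i, hi⟩ := List.mem_iff_get.1 (hsurj x)
    exact ⟨Fin.cast hll i, by simpa [f] using hi⟩
  have hfb : Function.Bijective f := Finite.surjective_iff_bijective.1 hf
  have hof : List.ofFn f = l := by
    apply List.ext_getElem
    · simp [hll]
    · intro i _ _; simp [f]
  refine ⟨(Equiv.ofBijective f hfb).symm, ?_, ?_⟩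
  · rw [isSh_iff]
    simp only [Equiv.symm_symm, Equiv.ofBijective_apply, Equiv.coe_ofBijective, hof]
    exact ⟨h2, h3⟩
  · simp only [lab, Equiv.symm_symm, Equiv.coe_ofBijective, hof]
    exact h1

theorem shWord_eq {V : Type*} (u v : List V) (σ : Equiv.Perm (Fin (u.length + v.length)))
    (h : IsSh u.length v.length σ) :
    shWord u v σ = FreeMonoid.ofList (mrg (lab _ _ σ) u v) := by
  unfold shWord
  congr 1
  set g : Fin (u.length + v.length) → V := fun i =>
    (u ++ v).get (Fin.cast (List.length_append (as := u) (bs := v)).symm i) with hg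
  have h1 := mrg_map g (lab _ _ σ) (lA _ _) (lB _ _)
  rw [mrg_lab h] at h1
  have hA : (lA u.length v.length).map g = u := by
    apply List.ext_getElem
    · simp [lA]
    · intro i h1 h2; simp [lA, hg, List.getElem_append_left h2]
  have hB : (lB u.length v.length).map g = v := by
    apply List.ext_getElem
    · simp [lB]
    · intro i h1 h2; simp [lB, hg]
  rw [hA, hB] at h1
  rw [h1, List.map_ofFn]
  rfl

theorem posCond_iff (p q : ℕ) (b : Bool) (x : Fin (p + q)) : posCond p b x ↔ fl p q x = b := by
  cases b <;> simp [posCond, fl]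

theorem quadOp_eq {V : Type*} (k : Type*) [CommRing k] (fb lb : Bool) (u v : List V) :
    quadOp k fb lb u v =
      ∑ b ∈ (labs u.length v.length).filter
        (fun b => b.head? = some fb ∧ b.getLast? = some lb),
        MonoidAlgebra.single (FreeMonoid.ofList (mrg b u v)) (1 : k) := by
  unfold quadOp
  have hcond : ∀ σ : Equiv.Perm (Fin (u.length + v.length)),
      (∃ h : 0 < u.length + v.length,
        posCond u.length fb (σ.symm ⟨0, h⟩) ∧
        posCond u.length lb (σ.symm ⟨u.length + v.length - 1, Nat.sub_lt h Nat.one_pos⟩)) ↔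
      ((lab _ _ σ).head? = some fb ∧ (lab _ _ σ).getLast? = some lb) := by
    intro σ
    simp only [posCond_iff]
    rw [List.head?_eq_getElem?, List.getLast?_eq_getElem?]
    simp only [List.getElem?_eq_some_iff]
    simp [lab]
    grind
  refine Finset.sum_bij (fun σ _ => lab _ _ σ) ?_ ?_ ?_ ?_
  · intro σ hσ
    simp only [mem_filter, mem_univ, true_and] at hσ
    rw [mem_filter]
    exact ⟨lab_mem hσ.1, (hcond σ).1 hσ.2⟩
  · intro σ hσ τ hτ e
    simp only [mem_filter, mem_univ, true_and] at hσ hτ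
    exact lab_inj hσ.1 hτ.1 e
  · intro b hb
    rw [mem_filter] at hb
    obtain ⟨σ, h1, h2⟩ := lab_surj hb.1
    refine ⟨σ, ?_, h2⟩
    simp only [mem_filter, mem_univ, true_and]
    exact ⟨h1, (hcond σ).2 (h2 ▸ hb.2)⟩
  · intro σ hσ
    simp only [mem_filter, mem_univ, true_and] at hσ
    rw [shWord_eq u v σ hσ.1]

theorem veeOp_eq {V : Type*} (k : Type*) [CommRing k] (u v : List V) :
    veeOp k u v =
      ∑ b ∈ (labs u.length v.length).filter (fun b => b.getLast? = some true),
        MonoidAlgebra.single (FreeMonoid.ofList (mrg b u v)) (1 : k) := by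
  unfold veeOp seOp swOp
  rw [quadOp_eq, quadOp_eq, ← Finset.sum_union]
  · refine Finset.sum_congr ?_ fun _ _ => rfl
    ext b
    simp only [mem_union, mem_filter]
    rcases b with _ | ⟨_ | _, b⟩ <;> simp
  · rw [Finset.disjoint_left]
    intro b h1 h2
    simp only [mem_filter] at h1 h2
    have := h1.2.1.symm.trans h2.2.1
    simp at this

theorem split_exists (b : List Bool) : ∀ n : ℕ, 1 ≤ n → n ≤ b.count true →
    ∃ b1 b2, b = b1 ++ b2 ∧ b1.getLast? = some true ∧ b1.count true = n := by
  induction b with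
  | nil => intro n h1 h2; simp at h2; omega
  | cons a b ih =>
    intro n h1 h2
    cases a
    · obtain ⟨b1, b2, rfl, h3, h4⟩ := ih n h1 (by simpa using h2)
      exact ⟨false :: b1, b2, rfl, by simp [List.getLast?_cons, h3], by simpa using h4⟩
    · by_cases hn : n = 1
      · subst hn
        exact ⟨[true], b, rfl, by simp, by simp⟩
      · obtain ⟨b1, b2, rfl, h3, h4⟩ := ih (n - 1) (by omega) (by simp at h2; omega)
        exact ⟨true :: b1, b2, rfl, by simp [List.getLast?_cons, h3], by simp; omega⟩

theorem split_aux (b1 c : List Bool) (h : (b1 ++ c).getLast? = some true)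
    (hc : (b1 ++ c).count true = b1.count true) : c = [] := by
  by_contra hne
  have h0 : c.count true = 0 := by simpa using hc
  rw [List.getLast?_append_of_ne_nil _ hne] at h
  exact List.count_eq_zero.1 h0 (List.mem_of_getLast? h)

theorem split_unique {b1 b2 c1 c2 : List Bool} (h : b1 ++ b2 = c1 ++ c2)
    (hb : b1.getLast? = some true) (hc : c1.getLast? = some true)
    (e : b1.count true = c1.count true) : b1 = c1 ∧ b2 = c2 := by
  rcases List.append_eq_append_iff.1 h with ⟨a, h1, h2⟩ | ⟨a, h1, h2⟩
  · subst h1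
    have := split_aux b1 a hc e.symm
    subst this; simpa using h2
  · subst h1
    have := split_aux c1 a hb e
    subst this; simpa using h2.symm

theorem statement4 (u v w : List V) (hv : v ≠ []) (hw : w ≠ []) :
    swOp k u (v ++ w) =
      ∑ i ∈ Finset.range (u.length + 1),
        swOp k (u.take i) v * veeOp k (u.drop i) w := by
  have hvl : 0 < v.length := List.length_pos_iff.2 hv
  have hwl : 0 < w.length := List.length_pos_iff.2 hw
  simp only [veeOp_eq, swOp, quadOp_eq, Finset.sum_mul_sum, MonoidAlgebra.single_mul_single,
    mul_one]
  simp only [← Finset.sum_product']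
  rw [Finset.sum_sigma']
  symm
  refine Finset.sum_bij (fun x _ => x.2.1 ++ x.2.2) ?_ ?_ ?_ ?_
  · rintro ⟨i, b1, b2⟩ h
    simp only [mem_sigma, mem_product, mem_filter, mem_labs, Finset.mem_range,
      List.length_take, List.length_drop] at h
    obtain ⟨hi, ⟨⟨h1, h2⟩, h3, h4⟩, ⟨h5, h6⟩, h7⟩ := h
    simp only [mem_filter, mem_labs, List.count_append, List.length_append]
    refine ⟨⟨by omega, by omega⟩, ?_, ?_⟩
    · simp [List.head?_append, h3]
    · simp [List.getLast?_append, h7]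
  · rintro ⟨i, b1, b2⟩ h ⟨j, c1, c2⟩ h' e
    simp only [mem_sigma, mem_product, mem_filter, mem_labs, Finset.mem_range,
      List.length_take, List.length_drop] at h h'
    obtain ⟨hi, ⟨⟨h1, h2⟩, h3, h4⟩, ⟨h5, h6⟩, h7⟩ := h
    obtain ⟨hi', ⟨⟨h1', h2'⟩, h3', h4'⟩, ⟨h5', h6'⟩, h7'⟩ := h'
    obtain ⟨rfl, rfl⟩ := split_unique e h4 h4' (h2.trans h2'.symm)
    have : i = j := by
      dsimp only at h1 h1' h5 h5' hi hi'
      omega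
    subst this; rfl
  · intro b hb
    simp only [mem_filter, mem_labs, List.length_append] at hb
    obtain ⟨⟨h1, h2⟩, h3, h4⟩ := hb
    obtain ⟨b1, b2, rfl, h5, h6⟩ := split_exists b v.length hvl (by omega)
    rw [List.count_append] at h1 h2
    have hb1 : b1 ≠ [] := by rintro rfl; simp at h5
    have hb2 : b2 ≠ [] := by rintro rfl; simp at h2; omega
    refine ⟨⟨b1.count false, b1, b2⟩, ?_, rfl⟩
    simp only [mem_sigma, mem_product, mem_filter, mem_labs, Finset.mem_range,
      List.length_take, List.length_drop]
    refine ⟨by omega, ⟨⟨by omega, h6⟩, ?_, h5⟩, ⟨by omega, by omega⟩, ?_⟩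
    · rwa [List.head?_append_of_ne_nil _ hb1] at h3
    · rwa [List.getLast?_append_of_ne_nil _ hb2] at h4
  · rintro ⟨i, b1, b2⟩ h
    simp only [mem_sigma, mem_product, mem_filter, mem_labs, Finset.mem_range] at h
    obtain ⟨hi, ⟨⟨h1, h2⟩, h3, h4⟩, ⟨h5, h6⟩, h7⟩ := h
    have := mrg_append b1 b2 (u.drop i) w (u.take i) v h1 h2
    rw [List.take_append_drop] at this
    simp only [this, FreeMonoid.ofList_append]
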